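/- Let A be a commutative noetherian ring with dim A ≤ 3, 𝔞 an ideal, and X ∈ D^+(A) a complex each of whose terms X^i is an 𝔞-cofinite A-module. Then Hom_A(A/𝔞, H^i(X)) is finitely generated for all i ≤ n+1 if and only if H^i(X) is 𝔞-cofinite for all i ≤ n. -/

import Mathlib

open CategoryTheory Limits

noncomputable section

variable {A : Type} [CommRing A]

/-- `Ext_A^i(A/𝔞, M)` as an `A`-module. -/
abbrev extQuot (𝔞 : Ideal A) (M : Type) [AddCommGroup M] [Module A M] (i : ℕ) : Type :=
  ↥(((_root_.Ext A (ModuleCat A) i).obj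
    (Opposite.op (ModuleCat.of A (A ⧸ 𝔞)))).obj (ModuleCat.of A M))

/-- `M` is an `𝔞`-cofinite `A`-module: `Supp M ⊆ V(𝔞)` and all `Ext_A^i(A/𝔞, M)`
are finitely generated. -/
def IsCofinite (𝔞 : Ideal A) (M : Type) [AddCommGroup M] [Module A M] : Prop :=
  Module.support A M ⊆ PrimeSpectrum.zeroLocus (𝔞 : Set A) ∧
    ∀ i : ℕ, Module.Finite A (extQuot 𝔞 M i)

/-- Homology of a short complex of modules as a quotient of the kernel. -/
lemma exists_homology_proj_sc (S : ShortComplex (ModuleCat.{0} A)) (H : ModuleCat.{0} A)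
    (e : H ≅ S.homology) :
    ∃ π : LinearMap.ker S.g.hom →ₗ[A] H, Function.Surjective π ∧
      ∀ z, π z = 0 ↔ ∃ y, S.f y = (z : S.X₂) := by
  let e' : H ≃ₗ[A] (LinearMap.ker S.g.hom ⧸ LinearMap.range S.moduleCatToCycles) :=
    (e ≪≫ S.moduleCatHomologyIso).toLinearEquiv
  refine ⟨e'.symm.toLinearMap.comp (Submodule.mkQ (LinearMap.range S.moduleCatToCycles)), ?_, ?_⟩
  · exact e'.symm.surjective.comp (Submodule.mkQ_surjective _)
  · intro z
    have h1 : (e'.symm.toLinearMap.comp (Submodule.mkQ (LinearMap.range S.moduleCatToCycles))) z = 0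
      ↔ Submodule.mkQ (LinearMap.range S.moduleCatToCycles) z = 0 :=
      e'.symm.map_eq_zero_iff
    rw [h1, Submodule.mkQ_apply, Submodule.Quotient.mk_eq_zero]
    constructor
    · rintro ⟨y, hy⟩
      exact ⟨y, congrArg Subtype.val hy⟩
    · rintro ⟨y, hy⟩
      exact ⟨y, Subtype.ext hy⟩

/-- Homology of a complex of modules as a quotient of the kernel. -/
lemma exists_homology_proj {ι : Type} {c : ComplexShape ι} (K : HomologicalComplex (ModuleCat.{0} A) c)
    (i j k : ι) (hi : c.prev j = i) (hk : c.next j = k) :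
    ∃ π : LinearMap.ker (K.d j k).hom →ₗ[A] K.homology j, Function.Surjective π ∧
      ∀ z, π z = 0 ↔ ∃ y, K.d i j y = (z : K.X j) :=
  exists_homology_proj_sc (K.sc' i j k) (K.homology j) (K.homologyIsoSc' i j k hi hk)

lemma finite_iff_of_surj {K H N : Type} [AddCommGroup K] [Module A K] [AddCommGroup H] [Module A H]
    [AddCommGroup N] [Module A N] (f : K →ₗ[A] H) (g : K →ₗ[A] N) (hf : Function.Surjective f)
    (hg : Function.Surjective g) (h : ∀ z, f z = 0 ↔ g z = 0) :
    Module.Finite A H ↔ Module.Finite A N := by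
  have hk : LinearMap.ker f = LinearMap.ker g := by ext z; simpa using h z
  let e : H ≃ₗ[A] N := (f.quotKerEquivOfSurjective hf).symm ≪≫ₗ Submodule.quotEquivOfEq _ _ hk ≪≫ₗ
    g.quotKerEquivOfSurjective hg
  exact ⟨fun _ => Module.Finite.equiv e, fun _ => Module.Finite.equiv e.symm⟩

/-- finiteness of `Ext` in the sense of derived categories. -/
def FE (𝔞 : Ideal A) (M : Type) [AddCommGroup M] [Module A M] (i : ℕ) : Prop :=
  Module.Finite A (Abelian.Ext (ModuleCat.of A (A ⧸ 𝔞)) (ModuleCat.of A M) i)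

lemma FE_zero_iff (𝔞 : Ideal A) (M : Type) [AddCommGroup M] [Module A M] :
    FE 𝔞 M 0 ↔ Module.Finite A ((A ⧸ 𝔞) →ₗ[A] M) := by
  let e : Abelian.Ext (ModuleCat.of A (A ⧸ 𝔞)) (ModuleCat.of A M) 0 ≃ₗ[A] ((A ⧸ 𝔞) →ₗ[A] M) :=
    (Abelian.Ext.linearEquiv₀ (R := A)).trans ModuleCat.homLinearEquiv
  exact ⟨fun h => by unfold FE at h; exact Module.Finite.equiv e,
    fun _ => by unfold FE; exact Module.Finite.equiv e.symm⟩

lemma extMk_smul' {X Y : ModuleCat.{0} A} (P : ProjectiveResolution X) (n : ℕ) (r : A)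
    (f : P.complex.X n ⟶ Y) (hf : P.complex.d (n+1) n ≫ f = 0)
    (hf' : P.complex.d (n+1) n ≫ (r • f) = 0) :
    P.extMk (r • f) (n+1) rfl hf' = r • P.extMk f (n+1) rfl hf := by
  rw [Abelian.Ext.smul_eq_comp_mk₀, P.extMk_comp_mk₀]
  congr 1

lemma proj_aug {X : ModuleCat.{0} A} (P : ProjectiveResolution X) :
    ∃ q : P.complex.X 0 ⟶ X, Epi q ∧ P.complex.d 1 0 ≫ q = 0 ∧
      ∀ (Y : ModuleCat.{0} A) (f : P.complex.X 0 ⟶ Y), P.complex.d 1 0 ≫ f = 0 →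
        ∃ g : X ⟶ Y, q ≫ g = f :=
  ⟨P.π.f 0, (inferInstance : ∀ n, Epi (P.π.f n)) 0, P.complex_d_comp_π_f_zero, fun _ f hf =>
    ⟨P.isColimitCokernelCofork.desc (CokernelCofork.ofπ f hf),
    P.isColimitCokernelCofork.fac (CokernelCofork.ofπ f hf) WalkingParallelPair.one⟩⟩

lemma extQuot_iff (𝔞 : Ideal A) (M : Type) [AddCommGroup M] [Module A M] (n : ℕ) :
    Module.Finite A (extQuot 𝔞 M n) ↔ FE 𝔞 M n := by
  let P := projectiveResolution (ModuleCat.of A (A ⧸ 𝔞))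
  let Y := ModuleCat.of A M
  let K := P.complex.linearYonedaObj A Y
  have h1 : Module.Finite A (extQuot 𝔞 M n) ↔ Module.Finite A (K.homology n) := by
    let e := (P.isoExt (R := A) n Y).toLinearEquiv
    exact ⟨fun _ => Module.Finite.equiv e, fun _ => Module.Finite.equiv e.symm⟩
  rw [h1]
  rcases n with _ | p
  · obtain ⟨π, hπ, hk⟩ := exists_homology_proj K 0 0 1 (by simp) (by simp)
    have hz : K.d 0 0 = 0 := K.shape _ _ (by simp)
    obtain ⟨q, hepi, hπ0, hq⟩ := proj_aug P
    let φ : ((ModuleCat.of A (A ⧸ 𝔞)) ⟶ Y) →ₗ[A] LinearMap.ker (K.d 0 1).hom :=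
      { toFun := fun g => ⟨q ≫ g, by
          change P.complex.d 1 0 ≫ q ≫ g = 0
          rw [← Category.assoc, hπ0, zero_comp]⟩
        map_add' := fun g h => Subtype.ext (Preadditive.comp_add _ _ _ _ _ _)
        map_smul' := fun r h => Subtype.ext (Linear.comp_smul _ _ _ _ _ _) }
    have hφs : Function.Surjective φ := fun z => by
      obtain ⟨g, hg⟩ := hq _ z.1 z.2
      exact ⟨g, Subtype.ext hg⟩
    have hφi : ∀ g, φ g = 0 → g = 0 := fun g hg => by
      have : q ≫ g = 0 := congrArg Subtype.val hg
      exact (cancel_epi _).1 (this.trans comp_zero.symm)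
    have hk' : ∀ z, π z = 0 ↔ z = 0 := fun z => by
      rw [hk, hz]
      exact ⟨fun ⟨y, hy⟩ => Subtype.ext hy.symm, fun h => ⟨0, by rw [h]; rfl⟩⟩
    have e2 : Abelian.Ext (ModuleCat.of A (A ⧸ 𝔞)) Y 0 ≃ₗ[A] (ModuleCat.of A (A ⧸ 𝔞) ⟶ Y) :=
      Abelian.Ext.linearEquiv₀ (R := A)
    refine finite_iff_of_surj (π.comp φ) e2.symm.toLinearMap (hπ.comp hφs) e2.symm.surjective ?_
    intro g
    have : e2.symm.toLinearMap g = 0 ↔ g = 0 := e2.symm.map_eq_zero_iff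
    rw [this, LinearMap.comp_apply, hk']
    exact ⟨hφi g, fun h => by rw [h, map_zero]⟩
  · obtain ⟨π, hπ, hk⟩ := exists_homology_proj K p (p+1) (p+2) (by simp) (by simp)
    let φ : LinearMap.ker (K.d (p+1) (p+2)).hom →ₗ[A]
        Abelian.Ext (ModuleCat.of A (A ⧸ 𝔞)) Y (p+1) :=
      { toFun := fun f => P.extMk f.1 (p+2) rfl f.2
        map_add' := fun f g => (P.add_extMk f.1 g.1 (p+2) rfl f.2 g.2).symm
        map_smul' := fun r f => extMk_smul' P (p+1) r f.1 f.2 (r • f).2 }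
    refine finite_iff_of_surj π φ hπ ?_ ?_
    · intro α
      obtain ⟨f, hf, rfl⟩ := P.extMk_surjective α (p+2) rfl
      exact ⟨⟨f, hf⟩, rfl⟩
    · intro z
      rw [hk]
      exact (P.extMk_eq_zero_iff z.1 (p+2) rfl z.2 p rfl).symm

lemma finite_of_exact' [IsNoetherianRing A] {X Y Z : Type} [AddCommGroup X] [Module A X]
    [AddCommGroup Y] [Module A Y] [AddCommGroup Z] [Module A Z] (f : X →ₗ[A] Y) (g : Y →ₗ[A] Z)
    (h : ∀ y, g y = 0 → ∃ x, f x = y) (hX : Module.Finite A X) (hZ : Module.Finite A Z) :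
    Module.Finite A Y := by
  have h1 : Module.Finite A (LinearMap.range g) := inferInstance
  refine ⟨?_⟩
  refine Submodule.fg_of_fg_map_of_fg_inf_ker g ?_ ?_
  · exact IsNoetherian.noetherian _
  · have : (⊤ ⊓ LinearMap.ker g : Submodule A Y) ≤ LinearMap.range f := by
      rintro y ⟨-, hy⟩
      exact h y hy
    have hr : IsNoetherian A (LinearMap.range f) := isNoetherian_of_isNoetherianRing_of_finite A _
    exact (isNoetherian_submodule.1 hr) _ this

section les
variable [IsNoetherianRing A] (𝔞 : Ideal A) {M' M M'' : Type} [AddCommGroup M'] [Module A M']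
  [AddCommGroup M] [Module A M] [AddCommGroup M''] [Module A M'']
  (f : M' →ₗ[A] M) (g : M →ₗ[A] M'') (hf : Function.Injective f) (hg : Function.Surjective g)
  (hfg : ∀ y, g y = 0 ↔ ∃ x, f x = y)

/-- the short complex -/
def mkS (hfg : ∀ y, g y = 0 ↔ ∃ x, f x = y) : ShortComplex (ModuleCat.{0} A) :=
  ShortComplex.mk (ModuleCat.ofHom f) (ModuleCat.ofHom g)
    (ModuleCat.hom_ext (LinearMap.ext fun x => (hfg _).2 ⟨x, rfl⟩))

include hf hg in
lemma mkS_exact : (mkS f g hfg).ShortExact :=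
  ModuleCat.shortComplex_shortExact _ (fun y => hfg y) hf hg

include hf hg hfg in
lemma FE_mid {i : ℕ} (h1 : FE 𝔞 M' i) (h3 : FE 𝔞 M'' i) : FE 𝔞 M i := by
  have hS := mkS_exact f g hf hg hfg
  exact finite_of_exact'
    ((Abelian.Ext.mk₀ (mkS f g hfg).f).postcompOfLinear A (ModuleCat.of A (A ⧸ 𝔞)) (add_zero i))
    ((Abelian.Ext.mk₀ (mkS f g hfg).g).postcompOfLinear A (ModuleCat.of A (A ⧸ 𝔞)) (add_zero i))
    (fun y hy => Abelian.Ext.covariant_sequence_exact₂ _ hS y hy) h1 h3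

include hf hg hfg in
lemma FE_left {i : ℕ} (h2 : FE 𝔞 M (i+1)) (h3 : FE 𝔞 M'' i) : FE 𝔞 M' (i+1) := by
  have hS := mkS_exact f g hf hg hfg
  exact finite_of_exact'
    (hS.extClass.postcompOfLinear A (ModuleCat.of A (A ⧸ 𝔞)) (rfl : i + 1 = i + 1))
    ((Abelian.Ext.mk₀ (mkS f g hfg).f).postcompOfLinear A (ModuleCat.of A (A ⧸ 𝔞)) (add_zero (i+1)))
    (fun y hy => Abelian.Ext.covariant_sequence_exact₁ _ hS y hy rfl) h3 h2

include hf hg hfg in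
lemma FE_right {i : ℕ} (h2 : FE 𝔞 M i) (h3 : FE 𝔞 M' (i+1)) : FE 𝔞 M'' i := by
  have hS := mkS_exact f g hf hg hfg
  exact finite_of_exact'
    ((Abelian.Ext.mk₀ (mkS f g hfg).g).postcompOfLinear A (ModuleCat.of A (A ⧸ 𝔞)) (add_zero i))
    (hS.extClass.postcompOfLinear A (ModuleCat.of A (A ⧸ 𝔞)) (rfl : i + 1 = i + 1))
    (fun y hy => Abelian.Ext.covariant_sequence_exact₃ _ hS y rfl hy) h2 h3

include hf in
lemma FE_left_zero (h2 : FE 𝔞 M 0) : FE 𝔞 M' 0 := by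
  rw [FE_zero_iff] at h2 ⊢
  exact Module.Finite.of_injective (f.compRight A : ((A ⧸ 𝔞) →ₗ[A] M') →ₗ[A] _) 
    (fun u v h => LinearMap.ext fun x => hf (LinearMap.congr_fun h x))

lemma FE_of_finite (hM : Module.Finite A M) (i : ℕ) : FE 𝔞 M i :=
  ModuleCat.finite_ext A (ModuleCat.of A (A ⧸ 𝔞)) (ModuleCat.of A M) i

/-- A submodule killed by `𝔞` is finitely generated. -/
lemma finite_of_FE_zero (h : FE 𝔞 M 0) (N : Submodule A M) (hN : ∀ x ∈ 𝔞, ∀ m ∈ N, x • m = 0) :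
    Module.Finite A N := by
  rw [FE_zero_iff] at h
  let ev : ((A ⧸ 𝔞) →ₗ[A] M) →ₗ[A] M := LinearMap.applyₗ (1 : A ⧸ 𝔞)
  have h2 : IsNoetherian A (LinearMap.range ev) := isNoetherian_of_isNoetherianRing_of_finite A _
  have : N ≤ LinearMap.range ev := by
    intro m hm
    refine ⟨Submodule.liftQ 𝔞 (LinearMap.toSpanSingleton A M m) ?_, ?_⟩
    · intro x hx
      exact hN x hx m hm
    · change (LinearMap.toSpanSingleton A M m) 1 = m
      simp
  exact ⟨(Submodule.fg_top N).2 ((isNoetherian_submodule.1 h2) _ this)⟩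

/-- Melkersson's criterion. -/
lemma FE_melkersson (x : A) (hx : x ∈ 𝔞)
    (h1 : ∀ i, FE 𝔞 (LinearMap.ker (LinearMap.lsmul A M x)) i)
    (h2 : ∀ i, FE 𝔞 (M ⧸ LinearMap.range (LinearMap.lsmul A M x)) i) (i : ℕ) : FE 𝔞 M i := by
  let φ : M →ₗ[A] M := LinearMap.lsmul A M x
  have hfg : ∀ y, φ.rangeRestrict y = 0 ↔ ∃ z, (LinearMap.ker φ).subtype z = y := by
    intro y
    rw [← LinearMap.mem_ker, LinearMap.ker_rangeRestrict]
    exact ⟨fun h => ⟨⟨y, h⟩, rfl⟩, fun ⟨z, hz⟩ => hz ▸ z.2⟩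
  have hfg2 : ∀ y, (LinearMap.range φ).mkQ y = 0 ↔ ∃ z, (LinearMap.range φ).subtype z = y := by
    intro y
    rw [Submodule.mkQ_apply, Submodule.Quotient.mk_eq_zero]
    exact ⟨fun h => ⟨⟨y, h⟩, rfl⟩, fun ⟨z, hz⟩ => hz ▸ z.2⟩
  have hS := mkS_exact _ _ (LinearMap.ker φ).injective_subtype φ.surjective_rangeRestrict hfg
  have hT := mkS_exact _ _ (LinearMap.range φ).injective_subtype (Submodule.mkQ_surjective _) hfg2
  let Q := ModuleCat.of A (A ⧸ 𝔞)
  let p := (Abelian.Ext.mk₀ (mkS _ _ hfg).g).postcompOfLinear A Q (add_zero i)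
  let ι := (Abelian.Ext.mk₀ (mkS _ _ hfg2).f).postcompOfLinear A Q (add_zero i)
  have hcomp : ∀ y, ι (p y) = 0 := by
    intro y
    have e1 : (mkS _ _ hfg).g ≫ (mkS _ _ hfg2).f = x • 𝟙 (ModuleCat.of A M) := rfl
    have e2 : x • 𝟙 Q = 0 := by
      refine ModuleCat.hom_ext (LinearMap.ext fun z => ?_)
      obtain ⟨z, rfl⟩ := Ideal.Quotient.mk_surjective z
      exact Ideal.Quotient.eq_zero_iff_mem.2 (Ideal.mul_mem_right z 𝔞 hx)
    change (y.comp (Abelian.Ext.mk₀ (mkS _ _ hfg).g) (add_zero i)).comp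
      (Abelian.Ext.mk₀ (mkS _ _ hfg2).f) (add_zero i) = 0
    have e3 : (y.comp (Abelian.Ext.mk₀ (mkS _ _ hfg).g) (add_zero i)).comp
      (Abelian.Ext.mk₀ (mkS _ _ hfg2).f) (add_zero i) =
      y.comp (Abelian.Ext.mk₀ ((mkS _ _ hfg).g ≫ (mkS _ _ hfg2).f)) (add_zero i) :=
      (Abelian.Ext.comp_assoc _ _ _ (add_zero i) (add_zero 0) (by simp)).trans
        (congrArg (fun t => y.comp t (add_zero i)) (Abelian.Ext.mk₀_comp_mk₀ _ _))
    rw [e3, e1]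
    refine (Abelian.Ext.smul_eq_comp_mk₀ y x).symm.trans ?_
    have e4 : x • y = (x • Abelian.Ext.mk₀ (𝟙 Q)).comp y (zero_add i) := by
      rw [Abelian.Ext.smul_comp, Abelian.Ext.mk₀_id_comp]
    rw [e4, ← Abelian.Ext.mk₀_smul, e2, Abelian.Ext.mk₀_zero, Abelian.Ext.zero_comp]
    rfl
  have hker : Module.Finite A (LinearMap.ker ι) := by
    rcases i with _ | j
    · have hm : Mono (mkS _ _ hfg2).f := hT.mono_f
      have hinj : ∀ z, ι z = 0 → z = 0 := fun z hz =>
        Abelian.Ext.postcomp_mk₀_injective_of_mono Q (mkS _ _ hfg2).f (hz.trans (map_zero ι).symm)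
      rw [LinearMap.ker_eq_bot'.2 hinj]
      infer_instance
    · let δ := hT.extClass.postcompOfLinear A Q (rfl : j + 1 = j + 1)
      have hle : LinearMap.ker ι ≤ LinearMap.range δ := fun z hz =>
        Abelian.Ext.covariant_sequence_exact₁ _ hT z hz rfl
      have : Module.Finite A (Abelian.Ext Q (mkS _ _ hfg2).X₃ j) := h2 j
      have h3 : IsNoetherian A (LinearMap.range δ) := isNoetherian_of_isNoetherianRing_of_finite A _
      exact ⟨(Submodule.fg_top _).2 ((isNoetherian_submodule.1 h3) _ hle)⟩
  refine finite_of_exact' ((Abelian.Ext.mk₀ (mkS _ _ hfg).f).postcompOfLinear A Q (add_zero i))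
    (p.codRestrict (LinearMap.ker ι) hcomp)
    (fun y hy => Abelian.Ext.covariant_sequence_exact₂ _ hS y (congrArg Subtype.val hy)) (h1 i) hker
end les

section ses
variable {M : Type} [AddCommGroup M] [Module A M]

lemma ker_ses (φ : M →ₗ[A] M) (y : M) :
    φ.rangeRestrict y = 0 ↔ ∃ z, (LinearMap.ker φ).subtype z = y := by
  rw [← LinearMap.mem_ker, LinearMap.ker_rangeRestrict]
  exact ⟨fun h => ⟨⟨y, h⟩, rfl⟩, fun ⟨z, hz⟩ => hz ▸ z.2⟩

lemma sub_ses (N : Submodule A M) (y : M) : N.mkQ y = 0 ↔ ∃ z, N.subtype z = y := by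
  rw [Submodule.mkQ_apply, Submodule.Quotient.mk_eq_zero]
  exact ⟨fun h => ⟨⟨y, h⟩, rfl⟩, fun ⟨z, hz⟩ => hz ▸ z.2⟩
end ses

lemma exists_nzd_or [IsNoetherianRing A] (𝔞 I : Ideal A) :
    (∃ x ∈ 𝔞, Ideal.Quotient.mk I x ∈ nonZeroDivisors (A ⧸ I)) ∨
      ∃ r, r ∉ I ∧ ∀ x ∈ 𝔞, x * r ∈ I := by
  by_contra hcon
  push Not at hcon
  obtain ⟨h1, h2⟩ := hcon
  have hd : Disjoint ((𝔞.map (Ideal.Quotient.mk I) : Ideal (A ⧸ I)) : Set (A ⧸ I))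
      (nonZeroDivisors (A ⧸ I)) := by
    rw [Set.disjoint_left]
    intro y hy hy'
    obtain ⟨x, hx, rfl⟩ := (Ideal.mem_map_iff_of_surjective _ Ideal.Quotient.mk_surjective).1 hy
    exact h1 x hx hy'
  obtain ⟨-, r, hr, hr0⟩ := SetLike.lt_iff_le_and_exists.1
    (Ideal.bot_lt_annihilator_of_disjoint_nonZeroDivisors hd)
  obtain ⟨r, rfl⟩ := Ideal.Quotient.mk_surjective r
  obtain ⟨x, hx, hxr⟩ := h2 r (fun h => hr0 (by simpa using Ideal.Quotient.eq_zero_iff_mem.2 h))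
  refine hxr (Ideal.Quotient.eq_zero_iff_mem.1 ?_)
  rw [map_mul, mul_comm]
  exact (Submodule.mem_annihilator.1 hr) _ (Ideal.mem_map_of_mem _ hx)

lemma dim_drop (I : Ideal A) (x : A) (hx : Ideal.Quotient.mk I x ∈ nonZeroDivisors (A ⧸ I)) :
    ringKrullDim (A ⧸ (I ⊔ Ideal.span {x})) + 1 ≤ ringKrullDim (A ⧸ I) := by
  refine ringKrullDim_succ_le_of_surjective (Ideal.Quotient.factor le_sup_left)
    (Ideal.Quotient.factor_surjective le_sup_left) hx ?_
  rw [Ideal.Quotient.factor_mk, Ideal.Quotient.eq_zero_iff_mem]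
  exact Ideal.mem_sup_right (Ideal.mem_span_singleton_self x)

lemma dim_mono (I J : Ideal A) (h : I ≤ J) : ringKrullDim (A ⧸ J) ≤ ringKrullDim (A ⧸ I) :=
  ringKrullDim_le_of_surjective (Ideal.Quotient.factor h) (Ideal.Quotient.factor_surjective h)

lemma le_of_add_one_le (a : WithBot ℕ∞) (d : ℕ) (h : a + 1 ≤ ((d + 1 : ℕ) : WithBot ℕ∞)) :
    a ≤ (d : WithBot ℕ∞) := by
  induction a using WithBot.recBotCoe with
  | bot => exact bot_le
  | coe a =>
    have h' : a + 1 ≤ ((d + 1 : ℕ) : ℕ∞) := by exact_mod_cast h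
    have : a ≤ (d : ℕ∞) := by
      push_cast at h'
      exact (ENat.add_le_add_iff_right (by simp)).1 h'
    exact_mod_cast this

lemma sup_kills {M : Type} [AddCommGroup M] [Module A M] (I : Ideal A) (r : A)
    (hI : ∀ s ∈ I, ∀ m : M, s • m = 0) :
    ∀ s ∈ I ⊔ Ideal.span {r}, ∀ m : LinearMap.ker (LinearMap.lsmul A M r), s • m = 0 := by
  intro s hs m
  obtain ⟨u, hu, v, hv, rfl⟩ := Submodule.mem_sup.1 hs
  obtain ⟨w, rfl⟩ := Ideal.mem_span_singleton'.1 hv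
  have hm : r • (m : M) = 0 := m.2
  refine Subtype.ext ?_
  change (u + w * r) • (m : M) = 0
  rw [add_smul, hI u hu, mul_smul, hm, smul_zero, zero_add]

section main
variable [IsNoetherianRing A] (𝔞 : Ideal A)

/-- elementwise torsion -/
def Tors (M : Type) [AddCommGroup M] [Module A M] : Prop :=
  ∀ x ∈ 𝔞, ∀ m : M, ∃ k : ℕ, x ^ k • m = 0

variable {𝔞} in
lemma Tors.sub {M : Type} [AddCommGroup M] [Module A M] (h : Tors 𝔞 M) (N : Submodule A M) :
    Tors 𝔞 N := fun x hx m => by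
  obtain ⟨k, hk⟩ := h x hx m
  exact ⟨k, Subtype.ext hk⟩

variable {𝔞} in
lemma Tors.quot {M N : Type} [AddCommGroup M] [Module A M] [AddCommGroup N] [Module A N]
    (h : Tors 𝔞 M) (f : M →ₗ[A] N) (hf : Function.Surjective f) :
    Tors 𝔞 N := fun x hx m => by
  obtain ⟨m, rfl⟩ := hf m
  obtain ⟨k, hk⟩ := h x hx m
  exact ⟨k, by rw [← map_smul, hk, map_zero]⟩

lemma tors_iff (M : Type) [AddCommGroup M] [Module A M] :
    Module.support A M ⊆ PrimeSpectrum.zeroLocus (𝔞 : Set A) ↔ Tors 𝔞 M := by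
  constructor
  · intro h x hx m
    have : x ∈ (Submodule.annihilator (Submodule.span A {m})).radical := by
      rw [Ideal.radical_eq_sInf, Ideal.mem_sInf]
      rintro p ⟨hp, hpp⟩
      have hs : (⟨p, hpp⟩ : PrimeSpectrum A) ∈ Module.support A M :=
        Module.mem_support_iff_exists_annihilator.2 ⟨m, hp⟩
      exact h hs hx
    obtain ⟨k, hk⟩ := this
    exact ⟨k, (Submodule.mem_annihilator_span_singleton m _).1 hk⟩
  · intro h p hp x hx
    obtain ⟨m, hm⟩ := Module.mem_support_iff_exists_annihilator.1 hp
    obtain ⟨k, hk⟩ := h x hx m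
    exact p.2.mem_of_pow_mem k (hm ((Submodule.mem_annihilator_span_singleton m _).2 hk))

/-- the range of multiplication by `r` is f.g. if `𝔞 r` kills `M` and `Hom(A/𝔞, M)` is f.g. -/
lemma range_finite (M : Type) [AddCommGroup M] [Module A M] (I : Ideal A) (r : A)
    (hI : ∀ s ∈ I, ∀ m : M, s • m = 0) (hr : ∀ x ∈ 𝔞, x * r ∈ I) (h : FE 𝔞 M 0) :
    Module.Finite A (LinearMap.range (LinearMap.lsmul A M r)) := by
  refine finite_of_FE_zero 𝔞 h _ ?_
  rintro x hx m ⟨m, rfl⟩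
  change x • r • m = 0
  rw [← mul_smul, hI _ (hr x hx)]

lemma fin0 (I : Ideal A) : ringKrullDim (A ⧸ I) ≤ 0 → ∀ (M : Type) [AddCommGroup M] [Module A M],
    (∀ s ∈ I, ∀ m : M, s • m = 0) → Tors 𝔞 M → FE 𝔞 M 0 → Module.Finite A M := by
  induction I using IsNoetherian.induction with
  | hgt I ih =>
  intro hdim M _ _ hI hT h0
  rcases exists_nzd_or 𝔞 I with ⟨x, hx, hxr⟩ | ⟨r, hrI, hr⟩
  · have h1 := (dim_drop I x hxr).trans hdim
    have h2 : ringKrullDim (A ⧸ (I ⊔ Ideal.span {x})) = ⊥ := by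
      revert h1
      generalize ringKrullDim (A ⧸ (I ⊔ Ideal.span {x})) = a
      intro h1
      induction a using WithBot.recBotCoe with
      | bot => rfl
      | coe a =>
        exfalso
        have : a + 1 ≤ 0 := by exact_mod_cast h1
        simp at this
    have h3 : I ⊔ Ideal.span {x} = ⊤ := by
      have h4 : Subsingleton (A ⧸ (I ⊔ Ideal.span {x})) := by
        by_contra hn
        have := not_subsingleton_iff_nontrivial.1 hn
        have h5 := ringKrullDim_nonneg_of_nontrivial (R := A ⧸ (I ⊔ Ideal.span {x}))
        rw [h2] at h5
        exact absurd h5 (by simp)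
      exact Ideal.Quotient.subsingleton_iff.1 h4
    have h5 : ∀ m : M, x • m = 0 → m = 0 := fun m hm => by
      have := sup_kills I x hI 1 (by rw [h3]; trivial) ⟨m, hm⟩
      rw [one_smul] at this
      exact congrArg Subtype.val this
    have h6 : ∀ k : ℕ, ∀ m : M, x ^ k • m = 0 → m = 0 := fun k => by
      induction k with
      | zero => intro m hm; simpa using hm
      | succ k ihk => intro m hm; rw [pow_succ, mul_smul] at hm; exact h5 m (ihk _ hm)
    have : Subsingleton M := ⟨fun a b => by
      obtain ⟨k, hk⟩ := hT x hx (a - b)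
      exact sub_eq_zero.1 (h6 k _ hk)⟩
    infer_instance
  · have hfin := range_finite 𝔞 M I r hI hr h0
    have hlt : I < I ⊔ Ideal.span {r} := lt_of_le_of_ne le_sup_left fun h =>
      hrI (h ▸ Ideal.mem_sup_right (Ideal.mem_span_singleton_self r))
    have hk := ih _ hlt ((dim_mono _ _ hlt.le).trans hdim)
      (LinearMap.ker (LinearMap.lsmul A M r)) (sup_kills I r hI) (hT.sub _)
      (FE_left_zero 𝔞 _ (Submodule.injective_subtype _) h0)
    exact finite_of_exact' _ _ (fun y hy => (ker_ses _ y).1 hy) hk hfin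

/-- The one-dimensional case with a parameter. -/
lemma fin1 (I : Ideal A) (x : A) (hx : x ∈ 𝔞)
    (hxr : Ideal.Quotient.mk I x ∈ nonZeroDivisors (A ⧸ I)) (hdim : ringKrullDim (A ⧸ I) ≤ 1)
    (M : Type) [AddCommGroup M] [Module A M]
    (hI : ∀ s ∈ I, ∀ m : M, s • m = 0) (hT : Tors 𝔞 M) (h0 : FE 𝔞 M 0) :
    Module.Finite A (LinearMap.ker (LinearMap.lsmul A M x)) ∧
      Module.Finite A (M ⧸ LinearMap.range (LinearMap.lsmul A M x)) := by
  have hd : ∀ k, ringKrullDim (A ⧸ (I ⊔ Ideal.span {x ^ k})) ≤ 0 := fun k =>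
    le_of_add_one_le _ 0 ((dim_drop I (x ^ k)
      (by rw [map_pow]; exact pow_mem hxr k)).trans (by simpa using hdim))
  have hfin : ∀ k, Module.Finite A (LinearMap.ker (LinearMap.lsmul A M (x ^ k))) := fun k =>
    fin0 𝔞 _ (hd k) _ (sup_kills I _ hI) (hT.sub _)
      (FE_left_zero 𝔞 _ (Submodule.injective_subtype _) h0)
  have hL : Module.Finite A (LinearMap.ker (LinearMap.lsmul A M x)) := by
    have h1 := hfin 1
    rwa [pow_one] at h1
  refine ⟨hL, ?_⟩
  have hart : IsArtinian A (LinearMap.ker (LinearMap.lsmul A M x)) := by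
    have hd1 := hd 1
    rw [pow_one] at hd1
    let J := I ⊔ Ideal.span {x}
    have : Ring.KrullDimLE 0 (A ⧸ J) := by
      rw [Ring.krullDimLE_iff]
      exact_mod_cast hd1
    have : IsArtinianRing (A ⧸ J) := isArtinianRing_iff_krullDimLE_zero.2 this
    have ht : Module.IsTorsionBySet A (LinearMap.ker (LinearMap.lsmul A M x)) (J : Set A) :=
      fun m s => sup_kills I x hI s.1 s.2 m
    letI := ht.module
    haveI := ht.isScalarTower (S := A)
    have : Module.Finite (A ⧸ J) (LinearMap.ker (LinearMap.lsmul A M x)) :=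
      Module.Finite.of_restrictScalars_finite A _ _
    have : IsArtinian (A ⧸ J) (LinearMap.ker (LinearMap.lsmul A M x)) := inferInstance
    exact isArtinian_of_surjective_algebraMap (S := A) (R := A ⧸ J)
      Ideal.Quotient.mk_surjective
  -- the descending chain
  let C : ℕ → Submodule A (LinearMap.ker (LinearMap.lsmul A M x)) := fun n =>
    (LinearMap.range (LinearMap.lsmul A M (x ^ n))).comap (Submodule.subtype _)
  have hC : Antitone C := antitone_nat_of_succ_le fun n => by
    rintro m ⟨w, hw⟩
    refine ⟨x • w, ?_⟩
    rw [← hw]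
    change x ^ n • x • w = x ^ (n + 1) • w
    rw [pow_succ, mul_smul]
  obtain ⟨n0, hn0⟩ := IsArtinian.monotone_stabilizes (⟨C, hC⟩ : ℕ →o (Submodule A _)ᵒᵈ)
  have key : ∀ n, ∀ m : M, x ^ (n0 + n) • m = 0 →
      ∃ u v : M, x ^ n0 • u = 0 ∧ m = u + x • v := by
    intro n
    induction n with
    | zero => intro m hm; exact ⟨m, 0, hm, by simp⟩
    | succ n ihn =>
      intro m hm
      have h1 : x • x ^ (n0 + n) • m = 0 := by
        rw [← mul_smul, ← pow_succ']; exact hm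
      have h2 : (⟨x ^ (n0 + n) • m, h1⟩ : LinearMap.ker (LinearMap.lsmul A M x)) ∈ C (n0 + n) :=
        ⟨m, rfl⟩
      have h3 : C (n0 + n) = C (n0 + n + 1) :=
        (hn0 (n0 + n) (by omega)).symm.trans (hn0 (n0 + n + 1) (by omega))
      rw [h3] at h2
      obtain ⟨m', hm'⟩ := h2
      have hm'' : x ^ (n0 + n + 1) • m' = x ^ (n0 + n) • m := hm'
      obtain ⟨u, v, hu, huv⟩ := ihn (m - x • m') (by
        rw [smul_sub, ← mul_smul, ← pow_succ, hm'', sub_self])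
      exact ⟨u, v + m', hu, by rw [smul_add, ← add_assoc, ← huv]; abel⟩
  have := hfin n0
  refine Module.Finite.of_surjective ((Submodule.mkQ _).comp
    (Submodule.subtype (LinearMap.ker (LinearMap.lsmul A M (x ^ n0))))) ?_
  intro y
  obtain ⟨m, rfl⟩ := Submodule.mkQ_surjective _ y
  obtain ⟨k, hk⟩ := hT x hx m
  obtain ⟨u, v, hu, rfl⟩ := key k m (by rw [pow_add, mul_smul, hk, smul_zero])
  refine ⟨⟨u, hu⟩, ?_⟩
  change Submodule.mkQ _ u = Submodule.mkQ _ (u + x • v)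
  rw [map_add, left_eq_add, Submodule.mkQ_apply, Submodule.Quotient.mk_eq_zero]
  exact ⟨v, rfl⟩

lemma kills_quot {M : Type} [AddCommGroup M] [Module A M] (I : Ideal A) (r : A)
    (hI : ∀ s ∈ I, ∀ m : M, s • m = 0) :
    ∀ s ∈ I ⊔ Ideal.span {r},
      ∀ m : M ⧸ LinearMap.range (LinearMap.lsmul A M r), s • m = 0 := by
  intro s hs m
  obtain ⟨u, hu, v, hv, rfl⟩ := Submodule.mem_sup.1 hs
  obtain ⟨w, rfl⟩ := Ideal.mem_span_singleton'.1 hv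
  obtain ⟨m, rfl⟩ := Submodule.mkQ_surjective _ m
  rw [← map_smul, Submodule.mkQ_apply, Submodule.Quotient.mk_eq_zero, add_smul, hI u hu,
    zero_add, mul_comm, mul_smul]
  exact ⟨w • m, rfl⟩

lemma crit_step (d : ℕ) (M : Type) [AddCommGroup M] [Module A M] (I : Ideal A) (r : A)
    (hI : ∀ s ∈ I, ∀ m : M, s • m = 0) (hr : ∀ x ∈ 𝔞, x * r ∈ I) (h : ∀ i ≤ d, FE 𝔞 M i)
    (hk : (∀ i ≤ d, FE 𝔞 (LinearMap.ker (LinearMap.lsmul A M r)) i) →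
      ∀ i, FE 𝔞 (LinearMap.ker (LinearMap.lsmul A M r)) i) (i : ℕ) : FE 𝔞 M i := by
  have hR : ∀ i, FE 𝔞 (LinearMap.range (LinearMap.lsmul A M r)) i :=
    FE_of_finite 𝔞 (range_finite 𝔞 M I r hI hr (h 0 (Nat.zero_le _)))
  have hK := hk fun i hi => by
    cases i with
    | zero => exact FE_left_zero 𝔞 _ (Submodule.injective_subtype _) (h 0 hi)
    | succ i =>
      exact FE_left 𝔞 _ _ (Submodule.injective_subtype _) (LinearMap.surjective_rangeRestrict _)
        (ker_ses _) (h _ hi) (hR i)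
  exact FE_mid 𝔞 _ _ (Submodule.injective_subtype _) (LinearMap.surjective_rangeRestrict _)
        (ker_ses _) (hK i) (hR i)

/-- The criterion in dimension `d + 1 ≤ 3`: it suffices to test `Ext^i`, `i ≤ d`. -/
lemma crit (d : ℕ) (hd3 : d ≤ 2) : ∀ (I : Ideal A),
    ringKrullDim (A ⧸ I) ≤ ((d + 1 : ℕ) : WithBot ℕ∞) →
    ∀ (M : Type) [AddCommGroup M] [Module A M],
    (∀ s ∈ I, ∀ m : M, s • m = 0) → Tors 𝔞 M → (∀ i ≤ d, FE 𝔞 M i) → ∀ i, FE 𝔞 M i := by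
  induction d with
  | zero =>
    intro I
    induction I using IsNoetherian.induction with
    | hgt I ih =>
    intro hdim M _ _ hI hT h
    rcases exists_nzd_or 𝔞 I with ⟨x, hx, hxr⟩ | ⟨r, hrI, hr⟩
    · obtain ⟨h1, h2⟩ := fin1 𝔞 I x hx hxr (by simpa using hdim) M hI hT (h 0 le_rfl)
      exact FE_melkersson 𝔞 x hx (FE_of_finite 𝔞 h1) (FE_of_finite 𝔞 h2)
    · have hlt : I < I ⊔ Ideal.span {r} := lt_of_le_of_ne le_sup_left fun h =>
        hrI (h ▸ Ideal.mem_sup_right (Ideal.mem_span_singleton_self r))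
      exact crit_step 𝔞 0 M I r hI hr h (ih _ hlt ((dim_mono _ _ hlt.le).trans hdim) _
        (sup_kills I r hI) (hT.sub _))
  | succ d ihd =>
    intro I
    induction I using IsNoetherian.induction with
    | hgt I ih =>
    intro hdim M _ _ hI hT h
    rcases exists_nzd_or 𝔞 I with ⟨x, hx, hxr⟩ | ⟨r, hrI, hr⟩
    · have hd := le_of_add_one_le _ _ ((dim_drop I x hxr).trans hdim)
      have hB0 : FE 𝔞 (LinearMap.range (LinearMap.lsmul A M x)) 0 :=
        FE_left_zero 𝔞 _ (Submodule.injective_subtype _) (h 0 (Nat.zero_le _))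
      have hL : ∀ i, FE 𝔞 (LinearMap.ker (LinearMap.lsmul A M x)) i := by
        refine ihd (by omega) _ hd _ (sup_kills I x hI) (hT.sub _) fun i hi => ?_
        have hi' : i = 0 ∨ i = 1 := by omega
        rcases hi' with rfl | rfl
        · exact FE_left_zero 𝔞 _ (Submodule.injective_subtype _) (h 0 (Nat.zero_le _))
        · exact FE_left 𝔞 _ _ (Submodule.injective_subtype _)
            (LinearMap.surjective_rangeRestrict _) (ker_ses _) (h 1 (by omega)) hB0
      have hB : ∀ i ≤ d + 1, FE 𝔞 (LinearMap.range (LinearMap.lsmul A M x)) i := fun i hi =>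
        FE_right 𝔞 _ _ (Submodule.injective_subtype _)
          (LinearMap.surjective_rangeRestrict _) (ker_ses _) (h i hi) (hL (i + 1))
      have hQ : ∀ i, FE 𝔞 (M ⧸ LinearMap.range (LinearMap.lsmul A M x)) i :=
        ihd (by omega) _ hd _ (kills_quot I x hI) (hT.quot _ (Submodule.mkQ_surjective _))
          fun i hi => FE_right 𝔞 _ _ (Submodule.injective_subtype _)
            (Submodule.mkQ_surjective _) (sub_ses _) (h i (by omega)) (hB (i + 1) (by omega))
      exact FE_melkersson 𝔞 x hx hL hQ
    · have hlt : I < I ⊔ Ideal.span {r} := lt_of_le_of_ne le_sup_left fun h =>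
        hrI (h ▸ Ideal.mem_sup_right (Ideal.mem_span_singleton_self r))
      exact crit_step 𝔞 (d + 1) M I r hI hr h (ih _ hlt ((dim_mono _ _ hlt.le).trans hdim) _
        (sup_kills I r hI) (hT.sub _))

end main

section final
variable [IsNoetherianRing A] (𝔞 : Ideal A)

/-- the SES `0 → B^j → Z^j → H^j → 0` -/
lemma homology_ses (X : CochainComplex (ModuleCat.{0} A) ℤ) (i j k : ℤ) (hij : i + 1 = j)
    (hjk : j + 1 = k) :
    ∃ (f : LinearMap.range (X.d i j).hom →ₗ[A] LinearMap.ker (X.d j k).hom)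
      (π : LinearMap.ker (X.d j k).hom →ₗ[A] X.homology j), Function.Injective f ∧
      Function.Surjective π ∧ ∀ y, π y = 0 ↔ ∃ z, f z = y := by
  have hle : LinearMap.range (X.d i j).hom ≤ LinearMap.ker (X.d j k).hom := by
    rintro _ ⟨y, rfl⟩
    have := X.d_comp_d i j k
    exact congrArg (fun φ => φ.hom y) this
  obtain ⟨π, hπ, h⟩ := exists_homology_proj X i j k (by simp; omega) (by simp; omega)
  refine ⟨Submodule.inclusion hle, π, Submodule.inclusion_injective hle, hπ, fun y => ?_⟩
  rw [h]
  constructor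
  · rintro ⟨w, hw⟩
    exact ⟨⟨_, ⟨w, rfl⟩⟩, Subtype.ext hw⟩
  · rintro ⟨⟨_, ⟨w, rfl⟩⟩, rfl⟩
    exact ⟨w, rfl⟩

lemma cyc_ses (X : CochainComplex (ModuleCat.{0} A) ℤ) (i j : ℤ)
    (y : X.X i) : (X.d i j).hom.rangeRestrict y = 0 ↔
      ∃ z, (LinearMap.ker (X.d i j).hom).subtype z = y := by
  rw [← LinearMap.mem_ker, LinearMap.ker_rangeRestrict]
  exact ⟨fun h => ⟨⟨y, h⟩, rfl⟩, fun ⟨z, hz⟩ => hz ▸ z.2⟩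

lemma FE_cyc (X : CochainComplex (ModuleCat.{0} A) ℤ) (hX : ∀ i m, FE 𝔞 (X.X i) m) (i j : ℤ) :
    FE 𝔞 (LinearMap.ker (X.d i j).hom) 0 ∧ FE 𝔞 (LinearMap.ker (X.d i j).hom) 1 :=
  ⟨FE_left_zero 𝔞 _ (Submodule.injective_subtype _) (hX i 0),
    FE_left 𝔞 _ _ (Submodule.injective_subtype _) (LinearMap.surjective_rangeRestrict _)
      (cyc_ses X i j) (hX i 1)
      (FE_left_zero 𝔞 _ (Submodule.injective_subtype _) (hX j 0))⟩

lemma FE_bound (X : CochainComplex (ModuleCat.{0} A) ℤ) (hX : ∀ i m, FE 𝔞 (X.X i) m) (i j : ℤ)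
    (h : ∀ m, FE 𝔞 (LinearMap.ker (X.d i j).hom) m) (m : ℕ) :
    FE 𝔞 (LinearMap.range (X.d i j).hom) m :=
  FE_right 𝔞 _ _ (Submodule.injective_subtype _) (LinearMap.surjective_rangeRestrict _)
      (cyc_ses X i j) (hX i m) (h (m + 1))

lemma FE_cyc_all (hdimA : ringKrullDim A ≤ 3) (X : CochainComplex (ModuleCat.{0} A) ℤ)
    (hX : ∀ i m, FE 𝔞 (X.X i) m) (hT : ∀ i, Tors 𝔞 (X.X i)) (i j : ℤ) (hij : i + 1 = j)
    (h : FE 𝔞 (X.homology j) 0) (m : ℕ) : FE 𝔞 (LinearMap.ker (X.d i j).hom) m := by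
  obtain ⟨f, π, hf, hπ, hfπ⟩ := homology_ses X i j (j + 1) hij rfl
  have hB1 : FE 𝔞 (LinearMap.range (X.d i j).hom) 1 :=
    FE_left 𝔞 f π hf hπ hfπ (FE_cyc 𝔞 X hX j (j + 1)).2 h
  have hZ2 : FE 𝔞 (LinearMap.ker (X.d i j).hom) 2 :=
    FE_left 𝔞 _ _ (Submodule.injective_subtype _) (LinearMap.surjective_rangeRestrict _)
      (cyc_ses X i j) (hX i 2) hB1
  refine crit 𝔞 2 le_rfl ⊥ ?_ _ ?_ ((hT i).sub _) ?_ m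
  · exact (ringKrullDim_le_of_surjective (Ideal.Quotient.mk (⊥ : Ideal A))
      Ideal.Quotient.mk_surjective).trans (by exact_mod_cast hdimA)
  · intro s hs z
    rw [Ideal.mem_bot.1 hs, zero_smul]
  · intro l hl
    interval_cases l
    · exact (FE_cyc 𝔞 X hX i j).1
    · exact (FE_cyc 𝔞 X hX i j).2
    · exact hZ2

end final

/-- If `dim A ≤ 3` and `X ∈ D^+(A)` is a complex of `𝔞`-cofinite modules, then
`Hom_A(A/𝔞, H^i(X))` is finitely generated for all `i ≤ n + 1` iff `H^i(X)` is
`𝔞`-cofinite for all `i ≤ n`. -/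
theorem stmt15 [IsNoetherianRing A] (hdimA : ringKrullDim A ≤ 3) (𝔞 : Ideal A)
    (X : CochainComplex (ModuleCat A) ℤ)
    (hplus : ∃ a : ℤ, ∀ i < a, Limits.IsZero (X.homology i))
    (hcof : ∀ i : ℤ, IsCofinite 𝔞 ↥(X.X i))
    (n : ℕ) :
    (∀ i : ℤ, i ≤ (n : ℤ) + 1 → Module.Finite A ((A ⧸ 𝔞) →ₗ[A] ↥(X.homology i))) ↔
      (∀ i : ℤ, i ≤ (n : ℤ) → IsCofinite 𝔞 ↥(X.homology i)) := by
  have hX : ∀ i m, FE 𝔞 (X.X i) m := fun i m => (extQuot_iff 𝔞 _ m).1 ((hcof i).2 m)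
  have hT : ∀ i, Tors 𝔞 (X.X i) := fun i => (tors_iff 𝔞 _).1 (hcof i).1
  constructor
  · intro h i hi
    obtain ⟨f, π, hf, hπ, hfπ⟩ := homology_ses X (i - 1) i (i + 1) (by omega) rfl
    have hZ : ∀ m, FE 𝔞 (LinearMap.ker (X.d i (i + 1)).hom) m :=
      FE_cyc_all 𝔞 hdimA X hX hT i (i + 1) rfl ((FE_zero_iff 𝔞 _).2 (h _ (by omega)))
    have hB : ∀ m, FE 𝔞 (LinearMap.range (X.d (i - 1) i).hom) m :=
      FE_bound 𝔞 X hX _ _ (FE_cyc_all 𝔞 hdimA X hX hT (i - 1) i (by omega)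
        ((FE_zero_iff 𝔞 _).2 (h _ (by omega))))
    exact ⟨(tors_iff 𝔞 _).2 (((hT i).sub _).quot π hπ), fun m => (extQuot_iff 𝔞 _ m).2
      (FE_right 𝔞 f π hf hπ hfπ (hZ m) (hB (m + 1)))⟩
  · intro h i hi
    have h0 : ∀ i : ℤ, i ≤ n → ∀ m, FE 𝔞 (X.homology i) m :=
      fun i hi m => (extQuot_iff 𝔞 _ m).1 ((h i hi).2 m)
    have key : FE 𝔞 (X.homology i) 0 := by
      rcases hi.lt_or_eq with hlt | heq
      · exact h0 i (by omega) 0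
      · obtain ⟨f, π, hf, hπ, hfπ⟩ := homology_ses X (i - 1) i (i + 1) (by omega) rfl
        obtain ⟨f', π', hf', hπ', hfπ'⟩ :=
          homology_ses X (i - 1 - 1) (i - 1) i (by omega) (by omega)
        have hB' : ∀ m, FE 𝔞 (LinearMap.range (X.d (i - 1 - 1) (i - 1)).hom) m :=
          FE_bound 𝔞 X hX _ _ (FE_cyc_all 𝔞 hdimA X hX hT _ _ (by omega)
            (h0 (i - 1) (by omega) 0))
        have hZ' : ∀ m, FE 𝔞 (LinearMap.ker (X.d (i - 1) i).hom) m := fun m =>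
          FE_mid 𝔞 f' π' hf' hπ' hfπ' (hB' m) (h0 (i - 1) (by omega) m)
        exact FE_right 𝔞 f π hf hπ hfπ (FE_cyc 𝔞 X hX i (i + 1)).1
          (FE_bound 𝔞 X hX _ _ hZ' 1)
    exact (FE_zero_iff 𝔞 _).1 key

end
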